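/- Let G be a finite simple graph, k a natural number, X a set of vertices of G, Ĝ the Karp digraph of G and X̂ = {(v,v') : v ∈ X}. Then there exists a set W of at most k vertices of G with W disjoint from X such that X is a minimum vertex cover of the induced subgraph G − W, if and only if there exists a set W' of at most k vertices of Ĝ such that X̂ is a set of arcs of the induced subdigraph Ĝ − W' and X̂ is a minimum feedback arc set of Ĝ − W'. -/

import Mathlib

/-- `X` is a feedback arc set of the digraph with arc relation `A`: a set of arcs
whose deletion leaves no directed cycle. -/
def IsFAS {C : Type*} (A : C → C → Prop) (X : Set (C × C)) : Prop :=
  (∀ p ∈ X, A p.1 p.2) ∧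
    ∀ a : C, ¬ Relation.TransGen (fun x y => A x y ∧ (x, y) ∉ X) a a

/-- `X` is a feedback arc set of smallest possible cardinality. -/
def IsMinFAS {C : Type*} (A : C → C → Prop) (X : Set (C × C)) : Prop :=
  IsFAS A X ∧ ∀ Y : Set (C × C), IsFAS A Y → X.ncard ≤ Y.ncard

/-- `X` is a feedback arc set no proper subset of which is a feedback arc set. -/
def IsMinimalFAS {C : Type*} (A : C → C → Prop) (X : Set (C × C)) : Prop :=
  IsFAS A X ∧ ∀ Y : Set (C × C), Y ⊂ X → ¬ IsFAS A Y

/-- `X` is a vertex cover of the simple graph `G`. -/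
def IsVC {C : Type*} (G : SimpleGraph C) (X : Set C) : Prop :=
  ∀ a b : C, G.Adj a b → a ∈ X ∨ b ∈ X

/-- `X` is a vertex cover of `G` of smallest possible cardinality. -/
def IsMinVC {C : Type*} (G : SimpleGraph C) (X : Set C) : Prop :=
  IsVC G X ∧ ∀ Y : Set C, IsVC G Y → X.ncard ≤ Y.ncard

/-- The Karp digraph of a simple graph `G`: vertices `v` (as `Sum.inl v`) and
`v'` (as `Sum.inr v`), an arc `(v, v')` for each vertex `v`, and arcs `(v', w)` and
`(w', v)` for each edge `{v, w}` of `G`. -/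
def karpArc {C : Type*} (G : SimpleGraph C) : (C ⊕ C) → (C ⊕ C) → Prop
  | Sum.inl v, Sum.inr w => v = w
  | Sum.inr v, Sum.inl w => G.Adj v w
  | _, _ => False

/-- The arc set `X̂ = {(v, v') : v ∈ X}` of the Karp digraph corresponding to
a vertex set `X`. -/
def karpArcs {C : Type*} (X : Set C) : Set ((C ⊕ C) × (C ⊕ C)) :=
  {p | ∃ v ∈ X, p = (Sum.inl v, Sum.inr v)}

/-- The arc relation of the induced subdigraph of `A` on the vertex set `S`. -/
def ArcsOn {C : Type*} (A : C → C → Prop) (S : Set C) : C → C → Prop :=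
  fun a b => A a b ∧ a ∈ S ∧ b ∈ S

/-- `X` is a vertex cover of the induced subgraph of `G` on the vertex set `S`. -/
def IsVCOn {C : Type*} (G : SimpleGraph C) (S X : Set C) : Prop :=
  X ⊆ S ∧ ∀ a ∈ S, ∀ b ∈ S, G.Adj a b → a ∈ X ∨ b ∈ X

/-- `X` is a minimum vertex cover of the induced subgraph of `G` on the vertex set `S`. -/
def IsMinVCOn {C : Type*} (G : SimpleGraph C) (S X : Set C) : Prop :=
  IsVCOn G S X ∧ ∀ Y : Set C, IsVCOn G S Y → X.ncard ≤ Y.ncard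

def kSurv {C : Type*} (W : Set (C ⊕ C)) : Set C := {v | Sum.inl v ∉ W ∧ Sum.inr v ∉ W}

def kUntag {C : Type*} : C ⊕ C → C := Sum.elim id id

lemma tg_step {D : Type*} {R : D → D → Prop} {a : D} (h : Relation.TransGen R a a) :
    ∃ b, R a b ∧ Relation.TransGen R b b := by
  obtain ⟨b, hab, hba⟩ := Relation.TransGen.head'_iff.1 h
  exact ⟨b, hab, Relation.TransGen.tail' hba hab⟩

lemma karp_fas_of_vc {C : Type*} (G : SimpleGraph C) (W : Set (C ⊕ C)) (T : Set C)
    (h : IsVCOn G (kSurv W) T) : IsFAS (ArcsOn (karpArc G) Wᶜ) (karpArcs T) := by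
  obtain ⟨hT, h⟩ := h
  refine ⟨?_, ?_⟩
  · rintro p ⟨v, hv, rfl⟩
    exact ⟨rfl, (hT hv).1, (hT hv).2⟩
  · have key : ∀ v : C, ¬ Relation.TransGen
        (fun x y => ArcsOn (karpArc G) Wᶜ x y ∧ (x, y) ∉ karpArcs T) (Sum.inl v) (Sum.inl v) := by
      intro v h0
      obtain ⟨b, ⟨⟨e1, m1, m2⟩, n1⟩, h1⟩ := tg_step h0
      rcases b with b | b
      · exact e1
      obtain rfl : v = b := e1
      obtain ⟨c, ⟨⟨e2, m3, m4⟩, n2⟩, h2⟩ := tg_step h1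
      rcases c with c | c
      swap
      · exact e2
      obtain ⟨d, ⟨⟨e3, m5, m6⟩, n3⟩, h3⟩ := tg_step h2
      rcases d with d | d
      · exact e3
      obtain rfl : c = d := e3
      rcases h v ⟨m1, m2⟩ c ⟨m5, m6⟩ e2 with hv | hc
      · exact n1 ⟨v, hv, rfl⟩
      · exact n3 ⟨c, hc, rfl⟩
    rintro (v | v) h0
    · exact key v h0
    · obtain ⟨c, ⟨⟨e2, m3, m4⟩, n2⟩, h2⟩ := tg_step h0
      rcases c with c | c
      · exact key c h2
      · exact e2

lemma karp_vc_of_fas {C : Type*} (G : SimpleGraph C) (W : Set (C ⊕ C))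
    (Y : Set ((C ⊕ C) × (C ⊕ C))) (h : IsFAS (ArcsOn (karpArc G) Wᶜ) Y) :
    IsVCOn G (kSurv W) (kSurv W ∩ (fun p => kUntag p.1) '' Y) := by
  refine ⟨Set.inter_subset_left, ?_⟩
  intro a ha b hb hab
  by_contra hcon
  push Not at hcon
  have na : ∀ z x, kUntag x = a → (x, z) ∉ Y := fun z x hx hy => hcon.1 ⟨ha, _, hy, hx⟩
  have nb : ∀ z x, kUntag x = b → (x, z) ∉ Y := fun z x hx hy => hcon.2 ⟨hb, _, hy, hx⟩
  refine h.2 (Sum.inl a) ?_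
  refine Relation.TransGen.head (b := Sum.inr a) ⟨⟨rfl, ha.1, ha.2⟩, na _ _ rfl⟩ ?_
  refine Relation.TransGen.head (b := Sum.inl b) ⟨⟨hab, ha.2, hb.1⟩, na _ _ rfl⟩ ?_
  refine Relation.TransGen.head (b := Sum.inr b) ⟨⟨rfl, hb.1, hb.2⟩, nb _ _ rfl⟩ ?_
  exact Relation.TransGen.single ⟨⟨hab.symm, hb.2, ha.1⟩, nb _ _ rfl⟩

lemma karpArcs_eq_image {C : Type*} (T : Set C) :
    karpArcs T = (fun v => ((Sum.inl v, Sum.inr v) : (C ⊕ C) × (C ⊕ C))) '' T := by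
  ext p
  simp [karpArcs, eq_comm]

lemma karpArcs_ncard {C : Type*} (T : Set C) : (karpArcs T).ncard = T.ncard := by
  rw [karpArcs_eq_image]
  apply Set.ncard_image_of_injective
  intro a b h
  simpa using h

lemma karp_min_iff {C : Type*} [Fintype C] (G : SimpleGraph C) (W : Set (C ⊕ C)) (X : Set C) :
    IsMinVCOn G (kSurv W) X ↔ IsMinFAS (ArcsOn (karpArc G) Wᶜ) (karpArcs X) := by
  constructor
  · rintro ⟨h, hm⟩
    refine ⟨karp_fas_of_vc G W X h, fun Y hY => ?_⟩
    rw [karpArcs_ncard]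
    refine (hm _ (karp_vc_of_fas G W Y hY)).trans ?_
    exact (Set.ncard_le_ncard Set.inter_subset_right (Set.toFinite _)).trans
      (Set.ncard_image_le (Set.toFinite _))
  · rintro ⟨h, hm⟩
    refine ⟨?_, fun Y hY => ?_⟩
    · have h2 := karp_vc_of_fas G W _ h
      have hX : X ⊆ kSurv W := fun v hv => (h.1 (Sum.inl v, Sum.inr v) ⟨v, hv, rfl⟩).2
      have e : (fun p : (C ⊕ C) × (C ⊕ C) => kUntag p.1) '' karpArcs X = X := by
        rw [karpArcs_eq_image, Set.image_image]
        simp [kUntag]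
      rwa [e, Set.inter_eq_right.2 hX] at h2
    · have := hm _ (karp_fas_of_vc G W Y hY)
      rwa [karpArcs_ncard, karpArcs_ncard] at this

/-- Correctness of the reduction from Minimum Vertex Cover Recognition Deletion to
Minimum FAS Recognition Deletion: one can delete at most `k` vertices of `G` (disjoint
from `X`) so that `X` becomes a minimum vertex cover of the remaining graph, iff one
can delete at most `k` vertices of the Karp digraph `Ĝ` so that `X̂` is a set of arcs
of the remaining digraph and a minimum feedback arc set of it. -/
theorem vc_recognition_deletion_iff_fas_recognition_deletion {C : Type*} [Fintype C]
    (G : SimpleGraph C) (k : ℕ) (X : Set C) :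
    (∃ W : Set C, W.ncard ≤ k ∧ Disjoint W X ∧ IsMinVCOn G Wᶜ X) ↔
      (∃ W' : Set (C ⊕ C), W'.ncard ≤ k ∧
        (∀ p ∈ karpArcs X, ArcsOn (karpArc G) W'ᶜ p.1 p.2) ∧
        IsMinFAS (ArcsOn (karpArc G) W'ᶜ) (karpArcs X)) := by
  constructor
  · rintro ⟨W, hk, -, hm⟩
    have e : kSurv (Sum.inl '' W : Set (C ⊕ C)) = Wᶜ := by
      ext v
      simp [kSurv]
    rw [← e, karp_min_iff] at hm
    exact ⟨Sum.inl '' W, (Set.ncard_image_le (Set.toFinite _)).trans hk, hm.1.1, hm⟩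
  · rintro ⟨W', hk, -, hm⟩
    rw [← karp_min_iff] at hm
    refine ⟨(kSurv W')ᶜ, ?_, ?_, ?_⟩
    · refine le_trans (le_trans (Set.ncard_le_ncard (t := kUntag '' W') ?_ (Set.toFinite _))
        (Set.ncard_image_le (Set.toFinite _))) hk
      intro v hv
      by_contra hc
      exact hv ⟨fun h => hc ⟨_, h, rfl⟩, fun h => hc ⟨_, h, rfl⟩⟩
    · exact Set.disjoint_left.2 fun v hv hx => hv (hm.1.1 hx)
    · rwa [compl_compl]
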